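/- Let (Σ, L, κ) be a state property system satisfying the axiom OrthoCom. Let (a_ω)_{ω ∈ Ω} be a family in L with a_ω ≤ ω for every ω ∈ Ω. Then κ(⨆_{ω ∈ Ω} a_ω) = ⋃_{ω ∈ Ω} κ(a_ω), and κ(a_ω) ∩ κ(a_{ω'}) = ∅ for distinct ω, ω' ∈ Ω. Moreover, for each ω ∈ Ω one has (⨆_{ω' ∈ Ω} a_{ω'}) ⊓ ω = a_ω. -/

import Mathlib

/-- A state property system `(σ, L, κ)` equipped with an orthocomplementation
satisfying the axiom **OrthoCom**. -/
structure OrthoSPS (σ : Type*) (L : Type*) [CompleteLattice L] where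
  /-- the Cartan map -/
  κ : L → Set σ
  κ_bot : κ ⊥ = ∅
  κ_top : κ ⊤ = Set.univ
  κ_sInf : ∀ s : Set L, κ (sInf s) = ⋂ a ∈ s, κ a
  le_iff : ∀ a b : L, a ≤ b ↔ κ a ⊆ κ b
  /-- the orthocomplementation -/
  perp : L → L
  perp_perp : ∀ a : L, perp (perp a) = a
  perp_anti : ∀ a b : L, a ≤ b → perp b ≤ perp a
  inf_perp : ∀ a : L, a ⊓ perp a = ⊥
  sup_perp : ∀ a : L, a ⊔ perp a = ⊤
  /-- axiom OrthoCom: any state orthogonal to every state in `κ a` lies in `κ (perp a)` -/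
  orthoCom : ∀ (a : L) (q : σ),
    (∀ p ∈ κ a, ∃ b : L, q ∈ κ b ∧ p ∈ κ (perp b)) → q ∈ κ (perp a)

namespace OrthoSPS

variable {σ : Type*} {L : Type*} [CompleteLattice L]

/-- orthogonality of two states: `p ⊥ q` -/
def PerpState (S : OrthoSPS σ L) (p q : σ) : Prop :=
  ∃ a : L, p ∈ S.κ a ∧ q ∈ S.κ (S.perp a)

/-- a property `a` is classical if every state is in `κ a` or in `κ (perp a)` -/
def IsClassical (S : OrthoSPS σ L) (a : L) : Prop :=
  ∀ p : σ, p ∈ S.κ a ∨ p ∈ S.κ (S.perp a)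

/-- the classical state `ω p` of a state `p`: the infimum of all classical properties
actual in `p` -/
def classicalState (S : OrthoSPS σ L) (p : σ) : L :=
  sInf {a : L | S.IsClassical a ∧ p ∈ S.κ a}

/-- `Ω`, the set of all classical states -/
def Omega (S : OrthoSPS σ L) : Set L :=
  Set.range S.classicalState

/-- the classical Cartan map `κ_c` -/
def κc (S : OrthoSPS σ L) (a : L) : Set L :=
  S.classicalState '' S.κ a

end OrthoSPS

namespace OrthoSPS

variable {σ : Type*} {L : Type*} [CompleteLattice L]

theorem κ_mono (S : OrthoSPS σ L) {a b : L} (hab : a ≤ b) : S.κ a ⊆ S.κ b :=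
  (S.le_iff a b).1 hab

theorem κ_inf (S : OrthoSPS σ L) (a b : L) : S.κ (a ⊓ b) = S.κ a ∩ S.κ b := by
  rw [← sInf_pair, S.κ_sInf, Set.biInter_pair]

theorem not_mem_κ_perp (S : OrthoSPS σ L) {a : L} {p : σ} (hp : p ∈ S.κ a) :
    p ∉ S.κ (S.perp a) := by
  intro hp'
  have hmem : p ∈ S.κ (a ⊓ S.perp a) := by
    rw [S.κ_inf]
    exact ⟨hp, hp'⟩
  rw [S.inf_perp, S.κ_bot] at hmem
  exact hmem

theorem IsClassical.perp {S : OrthoSPS σ L} {a : L} (ha : S.IsClassical a) :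
    S.IsClassical (S.perp a) := fun p => by
  rw [S.perp_perp]
  exact (ha p).symm

theorem IsClassical.sInf {S : OrthoSPS σ L} {s : Set L} (hs : ∀ a ∈ s, S.IsClassical a) :
    S.IsClassical (sInf s) := by
  intro p
  by_cases hp : ∀ a ∈ s, p ∈ S.κ a
  · left
    rw [S.κ_sInf]
    exact Set.mem_iInter₂.2 hp
  · right
    push Not at hp
    obtain ⟨a, has, hpa⟩ := hp
    exact S.κ_mono (S.perp_anti _ _ (sInf_le has)) ((hs a has p).resolve_left hpa)

theorem isClassical_classicalState (S : OrthoSPS σ L) (p : σ) :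
    S.IsClassical (S.classicalState p) :=
  IsClassical.sInf fun _ ha => ha.1

theorem mem_κ_classicalState (S : OrthoSPS σ L) (p : σ) : p ∈ S.κ (S.classicalState p) := by
  rw [classicalState, S.κ_sInf]
  exact Set.mem_iInter₂.2 fun _ ha => ha.2

theorem classicalState_le (S : OrthoSPS σ L) {a : L} {p : σ} (ha : S.IsClassical a)
    (hp : p ∈ S.κ a) : S.classicalState p ≤ a :=
  sInf_le ⟨ha, hp⟩

theorem classicalState_eq_of_mem (S : OrthoSPS σ L) {p q : σ}
    (hq : q ∈ S.κ (S.classicalState p)) : S.classicalState q = S.classicalState p := by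
  refine le_antisymm (S.classicalState_le (S.isClassical_classicalState p) hq)
    (S.classicalState_le (S.isClassical_classicalState q) ?_)
  refine (S.isClassical_classicalState q p).resolve_right fun hp => ?_
  exact S.not_mem_κ_perp (S.mem_κ_classicalState q)
    (S.κ_mono (S.classicalState_le (S.isClassical_classicalState q).perp hp) hq)

theorem isClassical_of_mem_Omega (S : OrthoSPS σ L) (w : S.Omega) : S.IsClassical (w : L) := by
  obtain ⟨_, p, rfl⟩ := w
  exact S.isClassical_classicalState p

theorem Omega_eq_of_mem (S : OrthoSPS σ L) {w w' : S.Omega} {q : σ}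
    (hq : q ∈ S.κ (w : L)) (hq' : q ∈ S.κ (w' : L)) : w = w' := by
  obtain ⟨_, p, rfl⟩ := w
  obtain ⟨_, p', rfl⟩ := w'
  exact Subtype.ext ((S.classicalState_eq_of_mem hq).symm.trans (S.classicalState_eq_of_mem hq'))

theorem mem_κ_perp_iSup (S : OrthoSPS σ L) {ι : Sort*} {a : ι → L} {p : σ}
    (hp : ∀ i, p ∈ S.κ (S.perp (a i))) : p ∈ S.κ (S.perp (⨆ i, a i)) := by
  have hle : ⨆ i, a i ≤ S.perp (sInf (Set.range fun i => S.perp (a i))) := iSup_le fun i => by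
    simpa only [S.perp_perp] using
      S.perp_anti _ _ (sInf_le (Set.mem_range_self (f := fun i => S.perp (a i)) i))
  have hle' := S.perp_anti _ _ hle
  rw [S.perp_perp] at hle'
  refine S.κ_mono hle' ?_
  rw [S.κ_sInf]
  simpa using hp

/-- A state of the supremum lies in the member of the family below its own classical state. -/
theorem mem_κ_of_mem_κ_iSup (S : OrthoSPS σ L) {a : S.Omega → L} (h : ∀ w : S.Omega, a w ≤ (w : L))
    {w : S.Omega} {q : σ} (hq : q ∈ S.κ (⨆ w, a w)) (hqw : q ∈ S.κ (w : L)) :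
    q ∈ S.κ (a w) := by
  rw [← S.perp_perp (a w)]
  refine S.orthoCom _ q fun p hp => ?_
  rcases S.isClassical_of_mem_Omega w p with hpw | hpw
  · refine ⟨_, hq, S.mem_κ_perp_iSup fun w' => ?_⟩
    by_cases hw : w = w'
    · exact hw ▸ hp
    · exact S.κ_mono (S.perp_anti _ _ (h w'))
        ((S.isClassical_of_mem_Omega w' p).resolve_left fun hp' => hw (S.Omega_eq_of_mem hpw hp'))
  · exact ⟨w, hqw, hpw⟩

end OrthoSPS

/-- for a family `(a_ω)_{ω ∈ Ω}` with `a_ω ≤ ω`, one has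
`κ (⨆ ω, a_ω) = ⋃ ω, κ (a_ω)` with pairwise disjoint pieces, and
`(⨆ ω', a_{ω'}) ⊓ ω = a_ω`. -/
theorem κ_iSup_family {σ L : Type*} [CompleteLattice L] (S : OrthoSPS σ L)
    (a : S.Omega → L) (h : ∀ w : S.Omega, a w ≤ (w : L)) :
    S.κ (⨆ w : S.Omega, a w) = (⋃ w : S.Omega, S.κ (a w)) ∧
    (∀ w w' : S.Omega, w ≠ w' → S.κ (a w) ∩ S.κ (a w') = ∅) ∧
    (∀ w : S.Omega, (⨆ w' : S.Omega, a w') ⊓ (w : L) = a w) := by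
  refine ⟨subset_antisymm (fun q hq => ?_) ?_, fun w w' hw => ?_, fun w => le_antisymm ?_ ?_⟩
  · exact Set.mem_iUnion.2 ⟨⟨_, Set.mem_range_self q⟩,
      S.mem_κ_of_mem_κ_iSup h hq (S.mem_κ_classicalState q)⟩
  · exact Set.iUnion_subset fun w => S.κ_mono (le_iSup a w)
  · refine Set.eq_empty_of_forall_notMem fun q hq => hw ?_
    exact S.Omega_eq_of_mem (S.κ_mono (h w) hq.1) (S.κ_mono (h w') hq.2)
  · rw [S.le_iff, S.κ_inf]
    exact fun q hq => S.mem_κ_of_mem_κ_iSup h hq.1 hq.2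
  · exact le_inf (le_iSup a w) (h w)
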